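/- There exist constants c > 0 and n_0 such that for all n ≥ n_0 the following holds. Let X_1,…,X_n be i.i.d. uniform {-1,1} bits, let k < log₂ n, and let M be a k-pass streaming algorithm with s bits of memory, together with an output bit that is a (possibly randomized) function of the final memory state M_{(k,n)}. If with probability at least 0.999 (over the input and all randomness) either Σ_{j=1}^n X_j = 0 or the output equals the sign of Σ_{j=1}^n X_j (the majority bit), then s ≥ c·(log₂ n)/k. -/

import Mathlib

open scoped Classical
open Finset

noncomputable section

namespace MultiPassIC

/-- Probability of an event under a probability mass function `p` on a finite sample space. -/
def pr {Ω : Type} [Fintype Ω] (p : Ω → ℝ) (E : Ω → Prop) : ℝ :=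
  ∑ ω, if E ω then p ω else 0

/-- `p` is a probability mass function on the finite type `Ω`. -/
structure IsPMF {Ω : Type} [Fintype Ω] (p : Ω → ℝ) : Prop where
  nonneg : ∀ ω, 0 ≤ p ω
  sum_one : ∑ ω, p ω = 1

/-- Shannon entropy (base 2) of the random variable `A` under `p`. -/
def H {Ω : Type} [Fintype Ω] {α : Type} [Fintype α] (p : Ω → ℝ) (A : Ω → α) : ℝ :=
  -∑ a, pr p (fun ω => A ω = a) * Real.logb 2 (pr p (fun ω => A ω = a))

/-- Conditional mutual information `I(A ; B ∣ C)` (base 2), with the usual conventions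
for vanishing probabilities. -/
def condMI {Ω : Type} [Fintype Ω] {α β γ : Type} [Fintype α] [Fintype β] [Fintype γ]
    (p : Ω → ℝ) (A : Ω → α) (B : Ω → β) (C : Ω → γ) : ℝ :=
  ∑ a, ∑ b, ∑ c,
    pr p (fun ω => A ω = a ∧ B ω = b ∧ C ω = c) *
      Real.logb 2 ((pr p (fun ω => C ω = c) *
          pr p (fun ω => A ω = a ∧ B ω = b ∧ C ω = c)) /
        (pr p (fun ω => A ω = a ∧ C ω = c) * pr p (fun ω => B ω = b ∧ C ω = c)))

/-- Mutual information `I(A ; B)` (base 2). -/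
def MI {Ω : Type} [Fintype Ω] {α β : Type} [Fintype α] [Fintype β]
    (p : Ω → ℝ) (A : Ω → α) (B : Ω → β) : ℝ :=
  condMI p A B (fun _ => (0 : Fin 1))

/-- `X 0, …, X (n-1)` (the first `n` stream elements) are mutually independent under `p`,
i.e. they are drawn from a product distribution. -/
def IsProduct {Ω : Type} [Fintype Ω] {𝒳 : Type} (p : Ω → ℝ) (n : ℕ) (X : ℕ → Ω → 𝒳) : Prop :=
  ∀ x : ℕ → 𝒳,
    pr p (fun ω => ∀ j < n, X j ω = x j) =
      ∏ j ∈ Finset.range n, pr p (fun ω => X j ω = x j)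

/-- A `k`-pass streaming algorithm on the input stream `X 0, …, X (n-1)` (0-indexed;
the paper's `X_j` is `X (j-1)`), over a finite sample space `Ω` with pmf `p`.
`S` is the finite set of memory states, `Rv` the value space of the per-step private
randomness, `init` the initial memory state `M₀`, `R i j` the private randomness used at
step `j` of pass `i` (0-indexed), and `f i j` the corresponding transition function.
The field `indep` states that the initial state, all the per-step random seeds, and the
input stream are mutually independent. -/
structure Alg (Ω : Type) [Fintype Ω] (p : Ω → ℝ) (𝒳 : Type) [Fintype 𝒳]
    (n k : ℕ) (X : ℕ → Ω → 𝒳) where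
  S : Type
  fintS : Fintype S
  Rv : Type
  fintR : Fintype Rv
  init : Ω → S
  R : ℕ → ℕ → Ω → Rv
  f : ℕ → ℕ → 𝒳 → S → Rv → S
  indep : ∀ (m : S) (r : ℕ → ℕ → Rv) (x : ℕ → 𝒳),
    pr p (fun ω => init ω = m ∧ (∀ i < k, ∀ j < n, R i j ω = r i j) ∧ (∀ j < n, X j ω = x j))
      = pr p (fun ω => init ω = m)
        * (∏ i ∈ Finset.range k, ∏ j ∈ Finset.range n, pr p (fun ω => R i j ω = r i j))
        * pr p (fun ω => ∀ j < n, X j ω = x j)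

attribute [instance] Alg.fintS Alg.fintR

variable {Ω : Type} [Fintype Ω] {p : Ω → ℝ} {𝒳 : Type} [Fintype 𝒳] {n k : ℕ} {X : ℕ → Ω → 𝒳}

/-- Running pass `i` (0-indexed) of the algorithm for `j` steps starting from `ini`. -/
def Alg.runPass (M : Alg Ω p 𝒳 n k X) (i : ℕ) (ini : Ω → M.S) : ℕ → Ω → M.S
  | 0 => ini
  | j + 1 => fun ω =>
      if j < n ∧ i < k then
        M.f i j (X j ω) (M.runPass i ini j ω) (M.R i j ω)
      else M.runPass i ini j ω

/-- `M.passEnd i` is the memory state at the end of pass `i`; `M.passEnd 0 = M₀` is the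
initial state, and `M.passEnd i` is the paper's `M_i = M_{(i,n)}`. -/
def Alg.passEnd (M : Alg Ω p 𝒳 n k X) : ℕ → Ω → M.S
  | 0 => M.init
  | i + 1 => M.runPass i (M.passEnd i) n

/-- `M.st i j` is the memory state after reading `j` elements in pass `i+1`;
it is the paper's `M_{(i+1, j)}`. -/
def Alg.st (M : Alg Ω p 𝒳 n k X) (i j : ℕ) : Ω → M.S :=
  M.runPass i (M.passEnd i) j

/-- The multi-pass information cost
`MIC(M, μ) = Σ_{i=1}^{k} Σ_{j=1}^{n} Σ_{ℓ=1}^{j} I(M_{(i,j)}; X_ℓ | M_{(≤i,ℓ-1)}, M_{(≤i-1,j)})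
  + Σ_{i=1}^{k} Σ_{j=1}^{n} Σ_{ℓ=j+1}^{n} I(M_{(i,j)}; X_ℓ | M_{(≤i-1,ℓ-1)}, M_{(≤i-1,j)})`
(all summation indices below are 0-indexed shifts of the paper's 1-indexed ones). -/
def Alg.MIC (M : Alg Ω p 𝒳 n k X) : ℝ :=
  (∑ i ∈ Finset.range k, ∑ j ∈ Finset.range n, ∑ l ∈ Finset.range (j + 1),
    condMI p (M.st i (j + 1)) (X l)
      (fun ω => ((fun r : Fin (i + 1) => M.st r.1 l ω),
                 (fun r : Fin i => M.st r.1 (j + 1) ω))))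
  + (∑ i ∈ Finset.range k, ∑ j ∈ Finset.range n, ∑ l ∈ Finset.Ico (j + 1) n,
    condMI p (M.st i (j + 1)) (X l)
      (fun ω => ((fun r : Fin i => M.st r.1 l ω),
                 (fun r : Fin i => M.st r.1 (j + 1) ω))))

/-- The conditional information cost
`MIC_cond(M, μ) = Σ_{j=1}^{n} Σ_{ℓ=1}^{j} I(M_{(≤k,j)}; X_ℓ | M_{<k}, M_{(≤k,ℓ-1)})`. -/
def Alg.MICcond (M : Alg Ω p 𝒳 n k X) : ℝ :=
  ∑ j ∈ Finset.range n, ∑ l ∈ Finset.range (j + 1),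
    condMI p (fun ω => fun r : Fin k => M.st r.1 (j + 1) ω) (X l)
      (fun ω => ((fun r : Fin k => M.passEnd r.1 ω),
                 (fun r : Fin k => M.st r.1 l ω)))

end MultiPassIC

namespace MultiPassIC

/-- The ±1 value of a boolean coin. -/
def coin (b : Bool) : ℝ := if b then 1 else -1

section Cube

open scoped BigOperators

variable {n : ℕ}

/-- The `j`-th coordinate of a point of the cube as a sign, and `0` when `j` is out of range. -/
def sgn (j : ℕ) (x : Fin n → Bool) : ℝ := if h : j < n then coin (x ⟨j, h⟩) else 0

/-- The sum of the signs with index in `[u, v)`. -/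
def blockSum (u v : ℕ) (x : Fin n → Bool) : ℝ := ∑ l ∈ Ico u v, sgn l x

/-- Negation of the `m`-th coordinate. -/
def flip (m : ℕ) (x : Fin n → Bool) : Fin n → Bool := fun i => if i.1 = m then !x i else x i

/-- The function `g` depends only on the coordinates with index below `u`. -/
def DependsBelow {β : Type*} (u : ℕ) (g : (Fin n → Bool) → β) : Prop :=
  ∀ x y, (∀ i : Fin n, i.1 < u → x i = y i) → g x = g y

lemma flip_flip (m : ℕ) (x : Fin n → Bool) : flip m (flip m x) = x := by
  funext i
  by_cases h : i.1 = m <;> simp [flip, h]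

lemma sgn_flip_self (m : ℕ) (x : Fin n → Bool) : sgn m (flip m x) = -sgn m x := by
  unfold sgn flip coin
  split_ifs <;> simp_all

lemma sgn_flip_of_ne {l m : ℕ} (h : l ≠ m) (x : Fin n → Bool) :
    sgn l (flip m x) = sgn l x := by
  unfold sgn flip
  split_ifs <;> simp_all

lemma blockSum_flip {u v m : ℕ} (h : m ∉ Ico u v) (x : Fin n → Bool) :
    blockSum u v (flip m x) = blockSum u v x :=
  sum_congr rfl fun l hl => sgn_flip_of_ne (by rintro rfl; exact h hl) x

lemma DependsBelow.flip_eq {β : Type*} {u m : ℕ} {g : (Fin n → Bool) → β}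
    (hg : DependsBelow u g) (h : u ≤ m) (x : Fin n → Bool) : g (flip m x) = g x :=
  hg _ _ fun i hi => if_neg (by omega)

lemma DependsBelow.mono {β : Type*} {u v : ℕ} {g : (Fin n → Bool) → β}
    (hg : DependsBelow u g) (h : u ≤ v) : DependsBelow v g :=
  fun x y hxy => hg x y fun i hi => hxy i (hi.trans_le h)

lemma sgn_sq_le (l : ℕ) (x : Fin n → Bool) : sgn l x ^ 2 ≤ 1 := by
  unfold sgn coin
  split_ifs <;> norm_num

lemma sgn_eq {l : ℕ} (h : l < n) (x : Fin n → Bool) : sgn l x = 1 ∨ sgn l x = -1 := by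
  unfold sgn coin
  split_ifs <;> simp

lemma dependsBelow_sgn (l : ℕ) : DependsBelow (l + 1) (sgn (n := n) l) := by
  intro x y h
  unfold sgn
  split_ifs with hl
  · rw [h ⟨l, hl⟩ (Nat.lt_succ_self l)]
  · rfl

lemma dependsBelow_blockSum (u v : ℕ) : DependsBelow v (blockSum (n := n) u v) :=
  fun x y h => sum_congr rfl fun l hl =>
    dependsBelow_sgn l x y fun i hi => h i (by simp at hl; omega)

lemma blockSum_add {u v w : ℕ} (huv : u ≤ v) (hvw : v ≤ w) (x : Fin n → Bool) :
    blockSum u v x + blockSum v w x = blockSum u w x :=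
  sum_Ico_consecutive _ huv hvw

lemma blockSum_succ {u v : ℕ} (huv : u ≤ v) (x : Fin n → Bool) :
    blockSum u (v + 1) x = blockSum u v x + sgn v x :=
  sum_Ico_succ_top huv _

lemma expect_flip (m : ℕ) (g : (Fin n → Bool) → ℝ) : 𝔼 x, g (flip m x) = 𝔼 x, g x :=
  Fintype.expect_equiv (Function.Involutive.toPerm (flip m) (flip_flip m)) _ _ fun _ => rfl

lemma expect_mul_sgn_eq_zero {m : ℕ} {g : (Fin n → Bool) → ℝ}
    (hg : ∀ x, g (flip m x) = g x) : 𝔼 x, g x * sgn m x = 0 := by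
  have h := expect_flip m fun x => g x * sgn m x
  simp only [hg, sgn_flip_self, mul_neg, expect_neg_distrib] at h
  linarith

lemma expect_blockSum_mul_blockSum {u v u' v' : ℕ} (h : Disjoint (Ico u v) (Ico u' v')) :
    𝔼 x : Fin n → Bool, blockSum u v x * blockSum u' v' x = 0 := by
  simp only [blockSum.eq_1 u' v', mul_sum]
  rw [expect_sum_comm]
  exact sum_eq_zero fun l hl => expect_mul_sgn_eq_zero fun x =>
    blockSum_flip (disjoint_right.1 h hl) x

lemma expect_blockSum_sq_le (u v : ℕ) :
    𝔼 x : Fin n → Bool, blockSum u v x ^ 2 ≤ (v - u : ℕ) := by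
  rcases le_total v u with h | h
  · simp [blockSum, h]
  induction v, h using Nat.le_induction with
  | base => simp [blockSum]
  | succ v huv ih =>
    have h0 : 𝔼 x : Fin n → Bool, (2 * blockSum u v x) * sgn v x = 0 :=
      expect_mul_sgn_eq_zero fun x => by rw [blockSum_flip (by simp)]
    have h1 : 𝔼 x : Fin n → Bool, sgn v x ^ 2 ≤ 1 :=
      expect_le univ_nonempty fun x _ => sgn_sq_le v x
    have h2 : ∀ x : Fin n → Bool, blockSum u (v + 1) x ^ 2
        = blockSum u v x ^ 2 + (2 * blockSum u v x) * sgn v x + sgn v x ^ 2 := fun x => by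
      rw [blockSum_succ huv]; ring
    simp only [h2, expect_add_distrib, h0]
    rw [Nat.succ_sub huv]
    push_cast
    linarith

lemma expect_blockSum_sq {m : ℕ} (hm : m ≤ n) :
    𝔼 x : Fin n → Bool, blockSum 0 m x ^ 2 = m := by
  induction m with
  | zero => simp [blockSum]
  | succ m ih =>
    have h0 : 𝔼 x : Fin n → Bool, (2 * blockSum 0 m x) * sgn m x = 0 :=
      expect_mul_sgn_eq_zero fun x => by rw [blockSum_flip (by simp)]
    have h2 : ∀ x : Fin n → Bool, blockSum 0 (m + 1) x ^ 2
        = blockSum 0 m x ^ 2 + (2 * blockSum 0 m x) * sgn m x + 1 := fun x => by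
      rw [blockSum_succ (Nat.zero_le m)]
      rcases sgn_eq hm x with h | h <;> rw [h] <;> ring
    simp only [h2, expect_add_distrib, h0, ih (by omega), Fintype.expect_const]
    push_cast
    ring

lemma expect_blockSum_pow_four_le {m : ℕ} (hm : m ≤ n) :
    𝔼 x : Fin n → Bool, blockSum 0 m x ^ 4 ≤ 3 * (m : ℝ) ^ 2 := by
  induction m with
  | zero => simp [blockSum]
  | succ m ih =>
    have h0 : 𝔼 x : Fin n → Bool,
        (4 * blockSum 0 m x ^ 3 + 4 * blockSum 0 m x) * sgn m x = 0 :=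
      expect_mul_sgn_eq_zero fun x => by rw [blockSum_flip (by simp)]
    have h2 : ∀ x : Fin n → Bool, blockSum 0 (m + 1) x ^ 4
        = blockSum 0 m x ^ 4 + 6 * blockSum 0 m x ^ 2
          + (4 * blockSum 0 m x ^ 3 + 4 * blockSum 0 m x) * sgn m x + 1 := fun x => by
      rw [blockSum_succ (Nat.zero_le m)]
      rcases sgn_eq hm x with h | h <;> rw [h] <;> ring
    simp only [h2, expect_add_distrib, ← mul_expect, h0, expect_blockSum_sq (by omega : m ≤ n),
      Fintype.expect_const]
    have := ih (by omega)
    push_cast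
    nlinarith

/-- One step of the exponential supermartingale bound for a predictable multiple of a sign. -/
lemma expect_mul_exp_sgn_le {m : ℕ} {P d : (Fin n → Bool) → ℝ} (hP0 : ∀ x, 0 ≤ P x)
    (hP : ∀ x, P (flip m x) = P x) (hd : ∀ x, d (flip m x) = d x) :
    𝔼 x, P x * Real.exp (d x * sgn m x - d x ^ 2 / 2) ≤ 𝔼 x, P x := by
  have h := expect_flip m fun x => P x * Real.exp (d x * sgn m x - d x ^ 2 / 2)
  simp only [hP, hd, sgn_flip_self] at h
  have key : ∀ x, P x * Real.exp (d x * sgn m x - d x ^ 2 / 2)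
      + P x * Real.exp (d x * -sgn m x - d x ^ 2 / 2) ≤ 2 * P x := fun x => by
    have hc := Real.cosh_le_exp_half_sq (d x * sgn m x)
    have hle : Real.exp ((d x * sgn m x) ^ 2 / 2) ≤ Real.exp (d x ^ 2 / 2) := by
      apply Real.exp_le_exp.2
      nlinarith [sgn_sq_le m x, sq_nonneg (d x)]
    rw [Real.cosh_eq] at hc
    have he : Real.exp (-(d x ^ 2 / 2)) * Real.exp (d x ^ 2 / 2) = 1 := by
      rw [← Real.exp_add]; simp
    have hpos := Real.exp_pos (-(d x ^ 2 / 2))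
    have : Real.exp (d x * sgn m x - d x ^ 2 / 2) + Real.exp (d x * -sgn m x - d x ^ 2 / 2)
        ≤ 2 := by
      rw [sub_eq_add_neg, sub_eq_add_neg, Real.exp_add, Real.exp_add, mul_neg]
      nlinarith
    nlinarith [hP0 x]
  have := expect_le_expect (s := univ) fun x _ => key x
  rw [expect_add_distrib, ← mul_expect] at this
  linarith

lemma expect_mul_exp_blockSum_le {u v : ℕ} (huv : u ≤ v) {P d : (Fin n → Bool) → ℝ}
    (hP0 : ∀ x, 0 ≤ P x) (hP : DependsBelow u P) (hd : DependsBelow u d) :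
    𝔼 x, P x * Real.exp (d x * blockSum u v x - d x ^ 2 * ((v - u : ℕ) : ℝ) / 2) ≤ 𝔼 x, P x := by
  induction v, huv using Nat.le_induction with
  | base => simp [blockSum]
  | succ v huv ih =>
    refine le_trans (le_of_eq ?_) ((expect_mul_exp_sgn_le (m := v) (d := d)
      (P := fun x => P x * Real.exp (d x * blockSum u v x - d x ^ 2 * ((v - u : ℕ) : ℝ) / 2))
      (fun x => mul_nonneg (hP0 x) (Real.exp_pos _).le) (fun x => ?_)
      (hd.flip_eq huv)).trans ih)
    · refine expect_congr rfl fun x _ => ?_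
      rw [mul_assoc, ← Real.exp_add, blockSum_succ huv, Nat.succ_sub huv]
      congr 2
      push_cast
      ring
    · have hb : blockSum u v (flip v x) = blockSum u v x := blockSum_flip (by simp) x
      simp only [hP.flip_eq huv, hd.flip_eq huv, hb]

lemma expect_exp_sum_blockSum_le (L : ℕ) {u : ℕ → ℕ} (hu : Monotone u)
    {d : ℕ → (Fin n → Bool) → ℝ} (hd : ∀ i, DependsBelow (u i) (d i)) :
    𝔼 x, Real.exp (∑ i ∈ range L, (d i x * blockSum (u i) (u (i + 1)) x
      - d i x ^ 2 * ((u (i + 1) - u i : ℕ) : ℝ) / 2)) ≤ 1 := by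
  induction L with
  | zero => simp
  | succ L ih =>
    simp only [sum_range_succ, Real.exp_add]
    refine (expect_mul_exp_blockSum_le (hu L.le_succ) (fun x => (Real.exp_pos _).le) ?_
      (hd L)).trans ih
    intro x y hxy
    refine congrArg Real.exp (sum_congr rfl fun i hi => ?_)
    have hi := mem_range.1 hi
    rw [((hd i).mono (hu hi.le)) x y hxy,
      ((dependsBelow_blockSum (u i) (u (i + 1))).mono (hu hi)) x y hxy]

/-- The average of `Y` over the fibre of `A` above `t`. -/
def fibreAvg {α τ : Type*} [Fintype α] (A : α → τ) (Y : α → ℝ) (t : τ) : ℝ :=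
  (∑ x with A x = t, Y x) / #{x | A x = t}

/-- If two points of the same fibre of `A` can be spliced so that `Y` sees the second point and
`g` sees the first, then `Y` and `g` are uncorrelated on each fibre of `A`. -/
lemma expect_mul_eq_expect_fibreAvg_mul {α τ : Type*} [Fintype α] [Fintype τ] {A : α → τ}
    {Y g : α → ℝ} (σ : α → α → α) (hσ : ∀ x y, σ (σ x y) (σ y x) = x)
    (hA : ∀ x y, A x = A y → A (σ x y) = A x) (hY : ∀ x y, A x = A y → Y (σ x y) = Y y)
    (hg : ∀ x y, A x = A y → g (σ x y) = g x) :
    𝔼 x, Y x * g x = 𝔼 x, fibreAvg A Y (A x) * g x := by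
  rw [Fintype.expect_eq_sum_div_card, Fintype.expect_eq_sum_div_card,
    ← sum_fiberwise univ A fun x => Y x * g x,
    ← sum_fiberwise univ A fun x => fibreAvg A Y (A x) * g x]
  congr 1
  refine sum_congr rfl fun t _ => ?_
  set R : Finset α := {x | A x = t} with hR
  have hmem : ∀ x, x ∈ R ↔ A x = t := fun x => by simp [hR]
  have hswap : ∑ q ∈ R ×ˢ R, Y q.1 * g q.1 = ∑ q ∈ R ×ˢ R, Y q.2 * g q.1 := by
    refine sum_nbij' (fun q => (σ q.1 q.2, σ q.2 q.1)) (fun q => (σ q.1 q.2, σ q.2 q.1))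
      ?_ ?_ (fun q _ => by simp [hσ]) (fun q _ => by simp [hσ]) ?_
    · rintro ⟨x, y⟩ h
      simp only [mem_product, hmem] at h ⊢
      exact ⟨(hA x y (h.1.trans h.2.symm)).trans h.1, (hA y x (h.2.trans h.1.symm)).trans h.2⟩
    · rintro ⟨x, y⟩ h
      simp only [mem_product, hmem] at h ⊢
      exact ⟨(hA x y (h.1.trans h.2.symm)).trans h.1, (hA y x (h.2.trans h.1.symm)).trans h.2⟩
    · rintro ⟨x, y⟩ h
      simp only [mem_product, hmem] at h ⊢
      rw [hY y x (h.2.trans h.1.symm), hg x y (h.1.trans h.2.symm)]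
  rw [sum_product, sum_product] at hswap
  simp only [sum_const, nsmul_eq_mul, ← sum_mul, ← mul_sum] at hswap
  have hR' : ∑ x ∈ R, fibreAvg A Y (A x) * g x = (∑ x ∈ R, Y x) / #R * ∑ x ∈ R, g x := by
    rw [mul_sum]
    exact sum_congr rfl fun x hx => by rw [(hmem x).1 hx]; rfl
  rw [hR']
  rcases R.eq_empty_or_nonempty with h | h
  · simp [h]
  · have : (#R : ℝ) ≠ 0 := by exact_mod_cast h.card_pos.ne'
    field_simp
    linarith

/-- The point that agrees with `y` on coordinates in `[u, v)` and with `x` elsewhere. -/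
def splice (u v : ℕ) (x y : Fin n → Bool) : Fin n → Bool :=
  fun i => if u ≤ i.1 ∧ i.1 < v then y i else x i

lemma splice_splice (u v : ℕ) (x y : Fin n → Bool) :
    splice u v (splice u v x y) (splice u v y x) = x := by
  funext i
  unfold splice
  split_ifs <;> rfl

lemma blockSum_splice (u v : ℕ) (x y : Fin n → Bool) :
    blockSum u v (splice u v x y) = blockSum u v y :=
  sum_congr rfl fun l hl => by simp [sgn, splice, mem_Ico.1 hl]

lemma blockSum_splice_of_disjoint {u v u' v' : ℕ} (h : v ≤ u' ∨ v' ≤ u) (x y : Fin n → Bool) :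
    blockSum u' v' (splice u v x y) = blockSum u' v' x :=
  sum_congr rfl fun l hl => by
    have := mem_Ico.1 hl
    have h' : ¬ (u ≤ l ∧ l < v) := by omega
    simp only [sgn, splice, if_neg h']

variable {σ : Type*}

/-- Abstract state trajectories of a multi-pass computation, where `Z j x` collects the states of
all passes after `j` input symbols. The block `[u, v)` of the input may be exchanged between inputs
whose states agree at `u` and `v`, and the state at `j` is determined by the initial one together
with the first `j` symbols. -/
structure IsTrace (Z : ℕ → (Fin n → Bool) → σ) : Prop where
  splice_eq : ∀ ⦃u v : ℕ⦄, u ≤ v → v ≤ n → ∀ x y, Z u x = Z u y → Z v x = Z v y →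
    ∀ j, j ≤ u ∨ v ≤ j → Z j (splice u v x y) = Z j x
  run : ∃ ρ : ℕ → σ → (Fin n → Bool) → σ,
    (∀ j x, Z j x = ρ j (Z 0 x) x) ∧ ∀ j z, DependsBelow j (ρ j z)

/-- The conditional mean of the block sum over `[u, v)` given the states at `u` and `v`. -/
def condBlock (Z : ℕ → (Fin n → Bool) → σ) (u v : ℕ) (x : Fin n → Bool) : ℝ :=
  fibreAvg (fun y => (Z u y, Z v y)) (blockSum u v) (Z u x, Z v x)

variable {Z : ℕ → (Fin n → Bool) → σ}

lemma IsTrace.condBlock_splice (hZ : IsTrace Z) {u v u' v' : ℕ} (huv : u ≤ v) (hvn : v ≤ n)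
    (hu' : u' ≤ u ∨ v ≤ u') (hv' : v' ≤ u ∨ v ≤ v') (x y : Fin n → Bool)
    (hu : Z u x = Z u y) (hv : Z v x = Z v y) :
    condBlock Z u' v' (splice u v x y) = condBlock Z u' v' x := by
  unfold condBlock
  rw [hZ.splice_eq huv hvn x y hu hv u' hu', hZ.splice_eq huv hvn x y hu hv v' hv']

variable [Fintype σ]

lemma IsTrace.expect_blockSum_mul (hZ : IsTrace Z) {u v : ℕ} (huv : u ≤ v) (hvn : v ≤ n)
    {g : (Fin n → Bool) → ℝ}
    (hg : ∀ x y, Z u x = Z u y → Z v x = Z v y → g (splice u v x y) = g x) :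
    𝔼 x, blockSum u v x * g x = 𝔼 x, condBlock Z u v x * g x := by
  refine expect_mul_eq_expect_fibreAvg_mul (A := fun x => (Z u x, Z v x)) (splice u v)
    (splice_splice u v) (fun x y h => ?_) (fun x y _ => blockSum_splice u v x y)
    fun x y h => ?_
  · rw [Prod.mk.injEq] at h
    exact Prod.ext (hZ.splice_eq huv hvn x y h.1 h.2 u (Or.inl le_rfl))
      (hZ.splice_eq huv hvn x y h.1 h.2 v (Or.inr le_rfl))
  · rw [Prod.mk.injEq] at h
    exact hg x y h.1 h.2

lemma IsTrace.expect_blockSum_mul_condBlock_self (hZ : IsTrace Z) {u v : ℕ} (huv : u ≤ v)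
    (hvn : v ≤ n) :
    𝔼 x, blockSum u v x * condBlock Z u v x = 𝔼 x, condBlock Z u v x ^ 2 := by
  simp only [sq]
  exact hZ.expect_blockSum_mul huv hvn
    (hZ.condBlock_splice huv hvn (Or.inl le_rfl) (Or.inr le_rfl))

lemma IsTrace.expect_condBlock_mul (hZ : IsTrace Z) {u v u' v' : ℕ} (huv : u ≤ v) (hvu : v ≤ u')
    (huv' : u' ≤ v') (hvn : v' ≤ n) :
    𝔼 x, condBlock Z u v x * condBlock Z u' v' x = 0 := by
  rw [← hZ.expect_blockSum_mul huv (by omega) (hZ.condBlock_splice huv (by omega)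
    (Or.inr hvu) (Or.inr (by omega)))]
  simp only [mul_comm (blockSum u v _)]
  rw [← hZ.expect_blockSum_mul huv' hvn
    (fun x y _ _ => blockSum_splice_of_disjoint (Or.inr hvu) x y)]
  exact expect_blockSum_mul_blockSum (disjoint_left.2 fun l h h' => by simp at h h'; omega)

lemma IsTrace.expect_sum_condBlock_sq (hZ : IsTrace Z) {N : ℕ} {w : ℕ → ℕ} (hw : Monotone w)
    (hN : w N ≤ n) :
    𝔼 x, (∑ b ∈ range N, condBlock Z (w b) (w (b + 1)) x) ^ 2
      = ∑ b ∈ range N, 𝔼 x, condBlock Z (w b) (w (b + 1)) x ^ 2 := by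
  simp only [sq, sum_mul_sum]
  rw [expect_sum_comm]
  refine sum_congr rfl fun b hb => ?_
  rw [expect_sum_comm]
  have hle : ∀ c ∈ range N, w (c + 1) ≤ n := fun c hc => (hw (mem_range.1 hc)).trans hN
  refine sum_eq_single b (fun c hc hcb => ?_) fun h => absurd hb h
  rcases lt_or_gt_of_ne hcb with h | h
  · simp only [mul_comm (condBlock Z (w b) _ _)]
    exact hZ.expect_condBlock_mul (hw c.le_succ) (hw h) (hw b.le_succ) (hle b hb)
  · exact hZ.expect_condBlock_mul (hw b.le_succ) (hw h) (hw c.le_succ) (hle c hc)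

lemma blockSum_eq_sum {w : ℕ → ℕ} (hw : Monotone w) (N : ℕ) (x : Fin n → Bool) :
    blockSum (w 0) (w N) x = ∑ b ∈ range N, blockSum (w b) (w (b + 1)) x := by
  induction N with
  | zero => simp [blockSum]
  | succ N ih => rw [sum_range_succ, ← ih, blockSum_add (hw N.zero_le) (hw N.le_succ)]

/-- If the final state is correlated with the total sum, then for every equipartition into short
blocks the states at the block boundaries determine a constant fraction of the variance. -/
lemma IsTrace.le_sum_expect_condBlock_sq (hZ : IsTrace Z) {h : σ → ℝ} (hh : ∀ z, |h z| ≤ 1) {a : ℝ}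
    (ha : 0 < a) (han : a ^ 2 = n) (hcor : 0.492 * a ≤ 𝔼 x, blockSum 0 n x * h (Z n x))
    {t o N : ℕ} (ho : o < t) (ht : 4096 * t ≤ n) (hN : (N + 1) * t ≤ n) (hN' : n < (N + 2) * t) :
    0.2 * n ≤ ∑ b ∈ range N, 𝔼 x, condBlock Z (o + b * t) (o + (b + 1) * t) x ^ 2 := by
  set w : ℕ → ℕ := fun b => o + b * t with hw
  have hwm : Monotone w := fun b c hbc => Nat.add_le_add_left (Nat.mul_le_mul_right t hbc) o
  have hwN : w N ≤ n := by simp only [hw]; nlinarith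
  have hw0 : w 0 = o := by simp [hw]
  have hpt : ∀ x, blockSum 0 n x * h (Z n x) ≤ blockSum (w 0) (w N) x * h (Z n x)
      + ((32 / a) * (blockSum 0 (w 0) x ^ 2 + blockSum (w N) n x ^ 2) + a / 64) := fun x => by
    rw [← blockSum_add (Nat.zero_le (w N)) hwN, ← blockSum_add (Nat.zero_le (w 0)) (hwm N.zero_le)]
    have hb : ∀ r : ℝ, r * h (Z n x) ≤ (32 / a) * r ^ 2 + a / 128 := fun r => by
      have h1 : r * h (Z n x) ≤ |r| := by
        refine (le_abs_self _).trans ?_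
        rw [abs_mul]
        exact mul_le_of_le_one_right (abs_nonneg r) (hh _)
      have h2 : (32 / a) * r ^ 2 + a / 128 - |r| = (32 / a) * (|r| - a / 64) ^ 2 := by
        rw [← sq_abs r]
        field_simp
        ring
      have h3 : 0 ≤ (32 / a) * (|r| - a / 64) ^ 2 := by positivity
      linarith
    have h1 := hb (blockSum 0 (w 0) x)
    have h2 := hb (blockSum (w N) n x)
    linarith
  have hE := expect_le_expect (s := univ) fun x _ => hpt x
  rw [expect_add_distrib, expect_add_distrib, ← mul_expect, expect_add_distrib,
    Fintype.expect_const] at hE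
  have hr1 := expect_blockSum_sq_le (n := n) 0 (w 0)
  have hr2 := expect_blockSum_sq_le (n := n) (w N) n
  have hlen : (((w 0 - 0 : ℕ) : ℝ)) + ((n - w N : ℕ) : ℝ) ≤ a ^ 2 / 2048 := by
    have : 2048 * ((w 0 - 0) + (n - w N)) ≤ n := by
      have : w N = o + N * t := rfl
      have : (N + 2) * t = N * t + 2 * t := by ring
      omega
    rw [han, le_div_iff₀ (by norm_num)]
    rw [mul_comm]
    exact_mod_cast this
  have hrest : (32 / a) * (𝔼 x : Fin n → Bool, blockSum 0 (w 0) x ^ 2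
      + 𝔼 x : Fin n → Bool, blockSum (w N) n x ^ 2) ≤ a / 64 := by
    calc _ ≤ (32 / a) * (a ^ 2 / 2048) := by gcongr; linarith
      _ = a / 64 := by field_simp; norm_num
  set C : (Fin n → Bool) → ℝ := fun x => ∑ b ∈ range N, condBlock Z (w b) (w (b + 1)) x with hC
  have hcond : 𝔼 x, blockSum (w 0) (w N) x * h (Z n x) = 𝔼 x, C x * h (Z n x) := by
    simp only [hC, blockSum_eq_sum hwm, sum_mul]
    rw [expect_sum_comm, expect_sum_comm]
    refine sum_congr rfl fun b hb => ?_
    have hbn : w (b + 1) ≤ n := (hwm (mem_range.1 hb)).trans hwN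
    exact hZ.expect_blockSum_mul (hwm b.le_succ) hbn fun x y hu hv =>
      congrArg h (hZ.splice_eq (hwm b.le_succ) hbn x y hu hv n (Or.inr hbn))
  rw [← hZ.expect_sum_condBlock_sq hwm hwN]
  change _ ≤ 𝔼 x, C x ^ 2
  have hsq : ∀ x, 0.92 * a * (C x * h (Z n x)) - 0.2116 * a ^ 2 ≤ C x ^ 2 := fun x => by
    have h1 : h (Z n x) ^ 2 ≤ 1 := (sq_le_one_iff_abs_le_one _).2 (hh _)
    nlinarith [sq_nonneg (C x - 0.46 * a * h (Z n x)), sq_nonneg a]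
  have hE2 := expect_le_expect (s := univ) fun x _ => hsq x
  rw [expect_sub_distrib, ← mul_expect, Fintype.expect_const] at hE2
  rw [← han]
  have : 0.46 * a ≤ 𝔼 x, C x * h (Z n x) := by rw [← hcond]; linarith
  nlinarith

/-- The state at a fixed time cannot be informative about many blocks of its past at once. -/
lemma IsTrace.sum_expect_condBlock_sq_le (hZ : IsTrace Z) {j : ℕ} (hj : j ≤ n) (L : ℕ)
    {u : ℕ → ℕ} (hu : Monotone u) (huj : ∀ i, u i ≤ j) {t : ℕ → ℝ} (ht : ∀ i, 0 < t i)
    (hlen : ∀ i, ((u (i + 1) - u i : ℕ) : ℝ) ≤ t i)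
    (hrest : ∀ i < L, ((j - u (i + 1) : ℕ) : ℝ) ≤ t i / 64) :
    ∑ i ∈ range L, ((𝔼 x, condBlock Z (u i) j x ^ 2) / (4 * t i) - 1 / 64)
      ≤ 2 * Real.log (Fintype.card σ) := by
  obtain ⟨ρ, hρ, hρd⟩ := hZ.run
  set d : ℕ → σ × σ → (Fin n → Bool) → ℝ := fun i α x =>
    fibreAvg (fun y => (Z (u i) y, Z j y)) (blockSum (u i) j) (ρ (u i) α.1 x, α.2) / t i with hd
  set Q : σ × σ → (Fin n → Bool) → ℝ := fun α x =>
    ∑ i ∈ range L, (d i α x * blockSum (u i) (u (i + 1)) x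
      - d i α x ^ 2 * ((u (i + 1) - u i : ℕ) : ℝ) / 2) with hQ
  have hQ1 : ∀ α, 𝔼 x, Real.exp (Q α x) ≤ 1 := fun α =>
    expect_exp_sum_blockSum_le L hu fun i x y hxy => by
      simp only [hd]
      rw [hρd (u i) α.1 x y hxy]
  have hdα : ∀ i x, d i (Z 0 x, Z j x) x = condBlock Z (u i) j x / t i := fun i x => by
    simp only [hd, ← hρ]
    rfl
  have : Nonempty σ := ⟨Z 0 fun _ => false⟩
  have hW : (0 : ℝ) < Fintype.card σ := by exact_mod_cast Fintype.card_pos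
  have hupper : 𝔼 x, Q (Z 0 x, Z j x) x ≤ 2 * Real.log (Fintype.card σ) := by
    have hB : Real.exp (2 * Real.log (Fintype.card σ)) = (Fintype.card σ : ℝ) ^ 2 := by
      rw [two_mul, Real.exp_add, Real.exp_log hW, sq]
    have hpt : ∀ x, Q (Z 0 x, Z j x) x + (1 - 2 * Real.log (Fintype.card σ))
        ≤ (∑ α, Real.exp (Q α x)) / (Fintype.card σ : ℝ) ^ 2 := fun x => by
      calc _ ≤ Real.exp (Q (Z 0 x, Z j x) x - 2 * Real.log (Fintype.card σ)) := by
            linarith [Real.add_one_le_exp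
              (Q (Z 0 x, Z j x) x - 2 * Real.log (Fintype.card σ))]
        _ = Real.exp (Q (Z 0 x, Z j x) x) / (Fintype.card σ : ℝ) ^ 2 := by
            rw [Real.exp_sub, hB]
        _ ≤ _ := by
            gcongr
            exact single_le_sum (f := fun α => Real.exp (Q α x))
              (fun α _ => (Real.exp_pos _).le) (mem_univ _)
    have hE := expect_le_expect (s := univ) fun x _ => hpt x
    rw [expect_add_distrib, Fintype.expect_const, ← expect_div,
      expect_sum_comm univ univ fun x α => Real.exp (Q α x)] at hE
    have hs : ∑ α : σ × σ, 𝔼 x, Real.exp (Q α x) ≤ (Fintype.card σ : ℝ) ^ 2 := by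
      refine (sum_le_sum fun α _ => hQ1 α).trans (le_of_eq ?_)
      simp [sq]
    have := (div_le_one (by positivity)).2 hs
    linarith
  refine le_trans ?_ hupper
  simp only [hQ, hdα]
  rw [expect_sum_comm]
  refine sum_le_sum fun i hi => ?_
  have hti := ht i
  have hpt : ∀ x, (1 / t i) * (blockSum (u i) j x * condBlock Z (u i) j x)
      - (3 / (4 * t i)) * condBlock Z (u i) j x ^ 2 - (1 / t i) * blockSum (u (i + 1)) j x ^ 2
      ≤ condBlock Z (u i) j x / t i * blockSum (u i) (u (i + 1)) x
      - (condBlock Z (u i) j x / t i) ^ 2 * ((u (i + 1) - u i : ℕ) : ℝ) / 2 := fun x => by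
    rw [← blockSum_add (hu i.le_succ) (huj (i + 1))]
    set c := condBlock Z (u i) j x
    set r := blockSum (u (i + 1)) j x
    set y := blockSum (u i) (u (i + 1)) x
    have h1 : (c / t i) ^ 2 * ((u (i + 1) - u i : ℕ) : ℝ) / 2 ≤ (c / t i) ^ 2 * t i / 2 := by
      gcongr
      exact hlen i
    have h2 : c / t i * y - (c / t i) ^ 2 * t i / 2 - ((1 / t i) * ((y + r) * c)
      - (3 / (4 * t i)) * c ^ 2 - (1 / t i) * r ^ 2) = (1 / t i) * (r - c / 2) ^ 2 := by
      field_simp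
      ring
    have h3 : 0 ≤ (1 / t i) * (r - c / 2) ^ 2 := by positivity
    linarith
  have hE := expect_le_expect (s := univ) fun x _ => hpt x
  rw [expect_sub_distrib, expect_sub_distrib, ← mul_expect, ← mul_expect, ← mul_expect,
    hZ.expect_blockSum_mul_condBlock_self (huj i) hj] at hE
  refine le_trans ?_ hE
  have hR : (1 / t i) * 𝔼 x : Fin n → Bool, blockSum (u (i + 1)) j x ^ 2 ≤ 1 / 64 := by
    calc _ ≤ (1 / t i) * (t i / 64) := by
          gcongr
          exact (expect_blockSum_sq_le _ _).trans (hrest i (mem_range.1 hi))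
      _ = 1 / 64 := by field_simp
  have : (𝔼 x, condBlock Z (u i) j x ^ 2) / (4 * t i)
      = (1 / t i) * 𝔼 x, condBlock Z (u i) j x ^ 2
        - (3 / (4 * t i)) * 𝔼 x, condBlock Z (u i) j x ^ 2 := by
    field_simp
    ring
  linarith

lemma sum_range_mul_eq (f : ℕ → ℝ) (N t : ℕ) :
    ∑ m ∈ range (N * t), f m = ∑ o ∈ range t, ∑ b ∈ range N, f (o + b * t) := by
  rw [sum_comm]
  induction N with
  | zero => simp
  | succ N ih =>
    rw [Nat.succ_mul, sum_range_add, ih, sum_range_succ]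
    simp only [add_comm]

/-- A trace whose final state is correlated with the sum of the input has many states. -/
theorem IsTrace.le_log_card (hZ : IsTrace Z) {h : σ → ℝ} (hh : ∀ z, |h z| ≤ 1) {a : ℝ}
    (ha : 0 < a) (han : a ^ 2 = n) (hcor : 0.492 * a ≤ 𝔼 x, blockSum 0 n x * h (Z n x))
    {L : ℕ} (hL : 64 ^ (L + 2) ≤ n) : 0.034 * (L : ℝ) ≤ 2 * Real.log (Fintype.card σ) := by
  set e : ℕ → ℕ → ℝ := fun t j => 𝔼 x, condBlock Z (j - t) j x ^ 2 with he
  have he0 : ∀ t j, 0 ≤ e t j := fun t j => expect_nonneg fun x _ => sq_nonneg _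
  have hn : (0 : ℝ) < n := by rw [← han]; positivity
  have hscale : ∀ t : ℕ, 0 < t → 4096 * t ≤ n → 0.2 * n * t ≤ ∑ j ∈ range n, e t j := by
    intro t ht htn
    obtain ⟨N, hN, hN'⟩ : ∃ N, (N + 1) * t ≤ n ∧ n < (N + 2) * t := by
      have h1 : 1 ≤ n / t := (Nat.one_le_div_iff ht).2 (by omega)
      refine ⟨n / t - 1, ?_, ?_⟩
      · rw [Nat.sub_add_cancel h1]
        exact Nat.div_mul_le_self n t
      · rw [show n / t - 1 + 2 = n / t + 1 by omega, mul_comm]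
        exact Nat.lt_mul_div_succ n ht
    have hle : ∑ m ∈ range (N * t), e t (t + m) ≤ ∑ j ∈ range n, e t j := by
      have hsub : range (t + N * t) ⊆ range n := range_subset_range.2 (by nlinarith)
      refine le_trans ?_ (sum_le_sum_of_subset_of_nonneg hsub fun j _ _ => he0 t j)
      rw [sum_range_add]
      linarith [sum_nonneg fun j (_ : j ∈ range t) => he0 t j]
    refine le_trans ?_ hle
    rw [sum_range_mul_eq]
    have : ∀ o ∈ range t, 0.2 * (n : ℝ) ≤ ∑ b ∈ range N, e t (t + (o + b * t)) := by
      intro o ho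
      refine (hZ.le_sum_expect_condBlock_sq hh ha han hcor (mem_range.1 ho) htn hN hN').trans
        (le_of_eq (sum_congr rfl fun b _ => ?_))
      simp only [he]
      rw [Nat.add_sub_cancel_left, show t + (o + b * t) = o + (b + 1) * t by ring]
    refine le_trans (le_of_eq ?_) (sum_le_sum this)
    simp
    ring
  have htime : ∀ j ∈ range n, ∑ i ∈ range L, (e (64 ^ (L - i)) j / (4 * (64 : ℝ) ^ (L - i)) - 1 / 64)
      ≤ 2 * Real.log (Fintype.card σ) := by
    intro j hj
    refine hZ.sum_expect_condBlock_sq_le (mem_range.1 hj).le L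
      (u := fun i => j - 64 ^ (L - i)) (t := fun i => (64 : ℝ) ^ (L - i)) ?_
      (fun i => Nat.sub_le _ _) (fun i => by positivity) (fun i => ?_) fun i hi => ?_
    · intro b c hbc
      exact Nat.sub_le_sub_left (Nat.pow_le_pow_right (by norm_num) (by omega)) j
    · have : j - 64 ^ (L - (i + 1)) - (j - 64 ^ (L - i)) ≤ 64 ^ (L - i) :=
        (Nat.sub_le_sub_right (Nat.sub_le j _) _).trans tsub_tsub_le
      exact_mod_cast this
    · rw [le_div_iff₀ (by norm_num)]
      have h1 : (64 : ℕ) ^ (L - i) = 64 ^ (L - (i + 1)) * 64 := by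
        rw [← pow_succ]
        congr 1
        omega
      have : (j - (j - 64 ^ (L - (i + 1)))) * 64 ≤ 64 ^ (L - i) := by
        rw [h1]
        exact Nat.mul_le_mul_right 64 tsub_tsub_le
      exact_mod_cast this
  have hsum := sum_le_sum htime
  rw [sum_comm, sum_const, card_range, nsmul_eq_mul] at hsum
  have hlow : ∀ i ∈ range L, 0.034 * (n : ℝ)
      ≤ ∑ j ∈ range n, (e (64 ^ (L - i)) j / (4 * (64 : ℝ) ^ (L - i)) - 1 / 64) := by
    intro i _
    have hpow : 64 ^ (L - i) ≤ 64 ^ L := Nat.pow_le_pow_right (by norm_num) (Nat.sub_le L i)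
    have h1 := hscale (64 ^ (L - i)) (by positivity) (by rw [pow_add] at hL; omega)
    rw [sum_sub_distrib, ← sum_div, sum_const, card_range, nsmul_eq_mul]
    have h2 : 0.05 * (n : ℝ) ≤ (∑ j ∈ range n, e (64 ^ (L - i)) j) / (4 * (64 : ℝ) ^ (L - i)) := by
      rw [le_div_iff₀ (by positivity)]
      push_cast at h1
      linarith
    linarith
  have := (sum_le_sum hlow).trans hsum
  rw [sum_const, card_range, nsmul_eq_mul] at this
  refine le_of_mul_le_mul_left ?_ hn
  linarith

variable {S : Type*}

/-- One pass over the input `x`, stopped after `j` symbols, with transition functions `g`. -/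
def detPass (g : ℕ → Bool → S → S) (x : Fin n → Bool) (s : S) : ℕ → S
  | 0 => s
  | j + 1 => if h : j < n then g j (x ⟨j, h⟩) (detPass g x s j) else detPass g x s j

/-- The state of a deterministic multi-pass algorithm after `i` full passes. -/
def detEnd (g : ℕ → ℕ → Bool → S → S) (x : Fin n → Bool) (m : S) : ℕ → S
  | 0 => m
  | i + 1 => detPass (g i) x (detEnd g x m i) n

/-- The states of all `k` passes after `j` input symbols. -/
def detTrace (k : ℕ) (g : ℕ → ℕ → Bool → S → S) (m : S) (j : ℕ) (x : Fin n → Bool) : Fin k → S :=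
  fun i => detPass (g i) x (detEnd g x m i) j

lemma detPass_eq_of_agree {g : ℕ → Bool → S → S} {x y : Fin n → Bool} {s s' : S} {u v : ℕ}
    (huv : u ≤ v) (hu : detPass g x s u = detPass g y s' u)
    (hxy : ∀ i : Fin n, u ≤ i.1 → i.1 < v → x i = y i) :
    detPass g x s v = detPass g y s' v := by
  induction v, huv using Nat.le_induction with
  | base => exact hu
  | succ v huv ih =>
    have ih := ih fun i h1 h2 => hxy i h1 (h2.trans v.lt_succ_self)
    simp only [detPass, ih]
    split_ifs with h
    · rw [hxy ⟨v, h⟩ huv v.lt_succ_self]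
    · rfl

lemma detPass_splice {g : ℕ → Bool → S → S} {x y : Fin n → Bool} {s s' : S} {u v j : ℕ}
    (huv : u ≤ v) (hu : detPass g x s u = detPass g y s' u)
    (hv : detPass g x s v = detPass g y s' v) (hj : j ≤ u ∨ v ≤ j) :
    detPass g (splice u v x y) s j = detPass g x s j := by
  have below : ∀ j ≤ u, detPass g (splice u v x y) s j = detPass g x s j := fun j hj =>
    detPass_eq_of_agree j.zero_le rfl fun i _ hi => if_neg (by omega)
  rcases hj with hj | hj
  · exact below j hj
  · refine detPass_eq_of_agree hj ?_ fun i hi _ => if_neg (by omega)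
    rw [hv]
    exact detPass_eq_of_agree huv ((below u le_rfl).trans hu) fun i h1 h2 => if_pos ⟨h1, h2⟩

lemma isTrace_detTrace (k : ℕ) (g : ℕ → ℕ → Bool → S → S) (m : S) :
    IsTrace (n := n) (detTrace k g m) where
  splice_eq u v huv hvn x y hu hv j hj := by
    have hend : ∀ i ≤ k, detEnd g (splice u v x y) m i = detEnd g x m i := by
      intro i
      induction i with
      | zero => intro _; rfl
      | succ i ih =>
        intro hi
        simp only [detEnd, ih (by omega)]
        exact detPass_splice huv (congrFun hu ⟨i, hi⟩) (congrFun hv ⟨i, hi⟩) (Or.inr hvn)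
    funext i
    simp only [detTrace, hend i i.2.le]
    exact detPass_splice huv (congrFun hu i) (congrFun hv i) hj
  run := ⟨fun j z x i => detPass (g i) x (z i) j, fun _ _ => rfl, fun j z x y hxy => by
    funext i
    exact detPass_eq_of_agree j.zero_le rfl fun i _ hi => hxy i hi⟩

/-- A statistic that predicts the sign of the sum well is correlated with the sum. -/
lemma le_expect_blockSum_mul {a : ℝ} (ha : 0 < a) (han : a ^ 2 = n)
    {r w : (Fin n → Bool) → ℝ} (hw1 : ∀ x, w x ≤ 1) (hw0 : ∀ x, 0 ≤ w x)
    (hrw : ∀ x, |blockSum 0 n x| * (2 * w x - 1) ≤ blockSum 0 n x * r x)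
    (hw : 0.999 ≤ 𝔼 x, w x) : 0.492 * a ≤ 𝔼 x, blockSum 0 n x * r x := by
  have hpt : ∀ x, (31 / (32 * a)) * blockSum 0 n x ^ 2 - (4 / (27 * a ^ 3)) * blockSum 0 n x ^ 4
      - 32 * a * (1 - w x) ≤ blockSum 0 n x * r x := fun x => by
    refine le_trans ?_ (hrw x)
    set b := |blockSum 0 n x| with hb
    have hb0 : 0 ≤ b := abs_nonneg _
    have h2 : blockSum 0 n x ^ 2 = b ^ 2 := (sq_abs _).symm
    have h4 : blockSum 0 n x ^ 4 = b ^ 4 := by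
      rw [show (4 : ℕ) = 2 * 2 from rfl, pow_mul, pow_mul, h2]
    rw [h2, h4]
    have h5 : b - b ^ 2 / a + (4 / (27 * a ^ 3)) * b ^ 4
        = b * (1 - 2 * b / (3 * a)) ^ 2 * (1 + b / (3 * a)) := by
      field_simp
      ring
    have h6 : 0 ≤ b * (1 - 2 * b / (3 * a)) ^ 2 * (1 + b / (3 * a)) := by positivity
    have h7 : (1 / (32 * a)) * b ^ 2 + 32 * a * (1 - w x) ^ 2 - 2 * b * (1 - w x)
        = (32 / a) * (b / 32 - a * (1 - w x)) ^ 2 := by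
      field_simp
      ring
    have h8 : 0 ≤ (32 / a) * (b / 32 - a * (1 - w x)) ^ 2 := by positivity
    have h9 : 32 * a * (1 - w x) ^ 2 ≤ 32 * a * (1 - w x) := by
      apply mul_le_mul_of_nonneg_left _ (by positivity)
      nlinarith [hw1 x, hw0 x]
    have h10 : (31 / (32 * a)) * b ^ 2 = b ^ 2 / a - (1 / (32 * a)) * b ^ 2 := by
      field_simp
      ring
    linarith
  have hE := expect_le_expect (s := univ) fun x _ => hpt x
  rw [expect_sub_distrib, expect_sub_distrib, ← mul_expect, ← mul_expect, ← mul_expect,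
    expect_sub_distrib, Fintype.expect_const, expect_blockSum_sq le_rfl, ← han] at hE
  refine le_trans ?_ hE
  have h4 := expect_blockSum_pow_four_le (n := n) le_rfl
  rw [← han] at h4
  have h5 : (4 / (27 * a ^ 3)) * 𝔼 x : Fin n → Bool, blockSum 0 n x ^ 4 ≤ (4 / 9) * a := by
    calc _ ≤ (4 / (27 * a ^ 3)) * (3 * (a ^ 2) ^ 2) := by gcongr
      _ = (4 / 9) * a := by field_simp; ring
  have h6 : (31 / (32 * a)) * a ^ 2 = (31 / 32) * a := by field_simp
  rw [h6]
  nlinarith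

/-- A deterministic multi-pass algorithm whose final state predicts the sign of the sum. -/
theorem log_le_of_detEnd [Fintype S] {k : ℕ} (hk : 0 < k) (g : ℕ → ℕ → Bool → S → S) (m : S)
    {h : S → ℝ} (hh : ∀ s, |h s| ≤ 1) {w : (Fin n → Bool) → ℝ} (hw1 : ∀ x, w x ≤ 1)
    (hw0 : ∀ x, 0 ≤ w x)
    (hhw : ∀ x, |blockSum 0 n x| * (2 * w x - 1) ≤ blockSum 0 n x * h (detEnd g x m k))
    (hw : 0.999 ≤ 𝔼 x, w x) (hn : 64 ^ 5 ≤ n) :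
    0.001 * Real.logb 2 n ≤ k * Real.logb 2 (Fintype.card S) := by
  have hnR : (0 : ℝ) < n := by exact_mod_cast (by omega : 0 < n)
  have hcor := le_expect_blockSum_mul (Real.sqrt_pos.2 hnR) (Real.sq_sqrt hnR.le) hw1 hw0 hhw hw
  obtain ⟨i, rfl⟩ : ∃ i, k = i + 1 := ⟨k - 1, by omega⟩
  have h5 : 5 ≤ Nat.log 64 n := Nat.le_log_of_pow_le (by norm_num) hn
  have key := (isTrace_detTrace (i + 1) g m).le_log_card (h := fun z => h (z (Fin.last i)))
    (fun z => hh _) (Real.sqrt_pos.2 hnR) (Real.sq_sqrt hnR.le) hcor (L := Nat.log 64 n - 2)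
    (by rw [Nat.sub_add_cancel (by omega)]; exact Nat.pow_log_le_self 64 (by omega))
  have hlt : (n : ℝ) ≤ 2 ^ (6 * (Nat.log 64 n + 1)) := by
    have := Nat.lt_pow_succ_log_self (b := 64) (by norm_num) n
    rw [pow_mul]
    norm_num
    exact_mod_cast this.le
  have hlog : Real.logb 2 n ≤ 6 * (Nat.log 64 n + 1) := by
    have := Real.logb_le_logb_of_le (b := 2) (by norm_num) hnR hlt
    rw [Real.logb_pow, Real.logb_self_eq_one (by norm_num)] at this
    push_cast at this
    linarith
  have h5R : (5 : ℝ) ≤ Nat.log 64 n := by exact_mod_cast h5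
  rw [Nat.cast_sub (by omega), Fintype.card_fun, Fintype.card_fin] at key
  push_cast at key
  rw [Real.log_pow] at key
  have hl2 : Real.log (Fintype.card S) = Real.logb 2 (Fintype.card S) * Real.log 2 := by
    rw [Real.logb, div_mul_cancel₀ _ (Real.log_pos (by norm_num)).ne']
  rw [hl2] at key
  have hlog2 : Real.log 2 < 1 := by linarith [Real.log_two_lt_d9]
  have hlog0 := Real.log_pos (by norm_num : (1 : ℝ) < 2)
  have : Nonempty S := ⟨m⟩
  have hc : 0 ≤ Real.logb 2 (Fintype.card S) :=
    Real.logb_nonneg (by norm_num) (by exact_mod_cast Fintype.card_pos)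
  push_cast at key ⊢
  have hq : 0 ≤ ((i : ℝ) + 1) * Real.logb 2 (Fintype.card S) := by positivity
  nlinarith

end Cube

section Reduction

open scoped BigOperators

variable {Ω : Type} {n k : ℕ} {X : ℕ → Ω → Bool}

/-- The input stream as a point of the cube. -/
def inputVec (n : ℕ) (X : ℕ → Ω → Bool) (ω : Ω) : Fin n → Bool := fun i => X i ω

lemma inputVec_eq_iff (x : ℕ → Bool) (ω : Ω) :
    inputVec n X ω = (fun i : Fin n => x i) ↔ ∀ j < n, X j ω = x j :=
  ⟨fun h j hj => congrFun h ⟨j, hj⟩, fun h => funext fun i => h i i.2⟩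

lemma exists_extend (x : Fin n → Bool) : ∃ x' : ℕ → Bool, x = fun i : Fin n => x' i :=
  ⟨fun j => if h : j < n then x ⟨j, h⟩ else false, by funext i; simp⟩

lemma blockSum_inputVec (ω : Ω) :
    blockSum 0 n (inputVec n X ω) = ∑ j ∈ range n, coin (X j ω) := by
  rw [blockSum, ← range_eq_Ico]
  exact sum_congr rfl fun j hj => dif_pos (mem_range.1 hj)

variable [Fintype Ω] {p : Ω → ℝ}

lemma pr_congr {E F : Ω → Prop} (h : ∀ ω, E ω ↔ F ω) : pr p E = pr p F := by
  rw [funext fun ω => propext (h ω)]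

lemma IsPMF.pr_nonneg (hp : IsPMF p) (E : Ω → Prop) : 0 ≤ pr p E :=
  sum_nonneg fun ω _ => by
    split_ifs
    exacts [hp.nonneg ω, le_rfl]

lemma IsPMF.pr_mono (hp : IsPMF p) {E F : Ω → Prop} (h : ∀ ω, E ω → F ω) : pr p E ≤ pr p F :=
  sum_le_sum fun ω _ => by
    have := hp.nonneg ω
    have := h ω
    split_ifs <;> simp_all

lemma sum_pr_mul {α : Type*} [Fintype α] (V : Ω → α) (G : α → ℝ) :
    ∑ a, pr p (fun ω => V ω = a) * G a = ∑ ω, p ω * G (V ω) := by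
  simp only [pr, sum_mul]
  rw [sum_comm]
  exact sum_congr rfl fun ω _ => by simp

lemma sum_pr_and {α : Type*} [Fintype α] (V : Ω → α) (E : Ω → Prop) :
    ∑ a, pr p (fun ω => E ω ∧ V ω = a) = pr p E := by
  simp only [pr]
  rw [sum_comm]
  refine sum_congr rfl fun ω _ => ?_
  by_cases h : E ω <;> simp [h]

/-- Averaging out a variable that is uniform and independent of `V`. -/
lemma sum_mul_eq_sum_mul_expect {α β : Type*} [Fintype α] [Fintype β] {V : Ω → α} {W : Ω → β}
    (h : ∀ a b, pr p (fun ω => V ω = a ∧ W ω = b) = pr p (fun ω => V ω = a) / Fintype.card β)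
    (G : α → β → ℝ) : ∑ ω, p ω * G (V ω) (W ω) = ∑ ω, p ω * 𝔼 b, G (V ω) b := by
  rw [← sum_pr_mul (fun ω => (V ω, W ω)) fun q => G q.1 q.2, ← sum_pr_mul V fun a => 𝔼 b, G a b,
    Fintype.sum_prod_type]
  refine sum_congr rfl fun a _ => ?_
  rw [Fintype.expect_eq_sum_div_card, sum_div, mul_sum]
  refine sum_congr rfl fun b _ => ?_
  simp only [Prod.mk.injEq, h]
  ring

lemma IsPMF.exists_le (hp : IsPMF p) {G : Ω → ℝ} {c : ℝ} (h : c ≤ ∑ ω, p ω * G ω) :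
    ∃ ω, c ≤ G ω := by
  by_contra! hlt
  have hle : ∑ ω, p ω * G ω ≤ ∑ ω, p ω * c :=
    sum_le_sum fun ω _ => mul_le_mul_of_nonneg_left (hlt ω).le (hp.nonneg ω)
  rw [← sum_mul, hp.sum_one, one_mul] at hle
  have heq : ∑ ω, p ω * (c - G ω) = 0 := by
    simp only [mul_sub, sum_sub_distrib, ← sum_mul, hp.sum_one, one_mul]
    linarith
  rw [sum_eq_zero_iff_of_nonneg fun ω _ =>
    mul_nonneg (hp.nonneg ω) (sub_nonneg.2 (hlt ω).le)] at heq
  have hzero : ∀ ω ∈ univ, p ω = 0 := fun ω hω =>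
    (mul_eq_zero.1 (heq ω hω)).resolve_right (sub_pos.2 (hlt ω)).ne'
  have := hp.sum_one
  rw [sum_eq_zero hzero] at this
  exact zero_ne_one this

/-- The initial state and all random seeds used by the algorithm. -/
def Alg.seed (M : Alg Ω p Bool n k X) (ω : Ω) : M.S × (Fin k → Fin n → M.Rv) :=
  (M.init ω, fun i j => M.R i j ω)

/-- The transition functions of the algorithm once the random seeds are fixed. -/
def Alg.detStep (M : Alg Ω p Bool n k X) (r : Fin k → Fin n → M.Rv) (i j : ℕ) (b : Bool)
    (s : M.S) : M.S :=
  if h : i < k ∧ j < n then M.f i j b s (r ⟨i, h.1⟩ ⟨j, h.2⟩) else s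

lemma Alg.passEnd_eq_detEnd (M : Alg Ω p Bool n k X) (ω : Ω) :
    ∀ i ≤ k, M.passEnd i ω
      = detEnd (M.detStep (M.seed ω).2) (inputVec n X ω) (M.seed ω).1 i := by
  intro i
  induction i with
  | zero => intro _; rfl
  | succ i ih =>
    intro hi
    have hrun : ∀ j, M.runPass i (M.passEnd i) j ω
        = detPass (M.detStep (M.seed ω).2 i) (inputVec n X ω) (M.passEnd i ω) j := by
      intro j
      induction j with
      | zero => rfl
      | succ j ihj =>
        have hik : i < k := hi
        by_cases hj : j < n
        · simp only [Alg.runPass, detPass, ← ihj, Alg.detStep, hj, hik, and_self, if_true,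
            dif_pos]
          rfl
        · simp only [Alg.runPass, detPass, ← ihj, hj, false_and, if_false, dif_neg,
            not_false_eq_true]
    rw [Alg.passEnd, hrun, ih (by omega)]
    rfl

lemma pr_inputVec (hX : IsProduct p n X)
    (hu : ∀ j < n, ∀ b : Bool, pr p (fun ω => X j ω = b) = 1 / 2) (x : Fin n → Bool) :
    pr p (fun ω => inputVec n X ω = x) = 1 / Fintype.card (Fin n → Bool) := by
  obtain ⟨x, rfl⟩ := exists_extend x
  rw [pr_congr (inputVec_eq_iff x), hX x,
    prod_congr rfl fun j hj => hu j (mem_range.1 hj) (x j)]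
  simp

lemma Alg.pr_seed_and_inputVec (M : Alg Ω p Bool n k X) (hp : IsPMF p) (hX : IsProduct p n X)
    (hu : ∀ j < n, ∀ b : Bool, pr p (fun ω => X j ω = b) = 1 / 2)
    (v : M.S × (Fin k → Fin n → M.Rv)) (x : Fin n → Bool) :
    pr p (fun ω => M.seed ω = v ∧ inputVec n X ω = x)
      = pr p (fun ω => M.seed ω = v) / Fintype.card (Fin n → Bool) := by
  obtain ⟨ω₀⟩ : Nonempty Ω := by
    by_contra h
    rw [not_nonempty_iff] at h
    simpa using hp.sum_one
  obtain ⟨A, hA⟩ : ∃ A : ℝ, ∀ y : Fin n → Bool,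
      pr p (fun ω => M.seed ω = v ∧ inputVec n X ω = y) = A / Fintype.card (Fin n → Bool) := by
    set r : ℕ → ℕ → M.Rv := fun i j =>
      if h : i < k ∧ j < n then v.2 ⟨i, h.1⟩ ⟨j, h.2⟩ else M.R 0 0 ω₀ with hr
    refine ⟨pr p (fun ω => M.init ω = v.1) *
      ∏ i ∈ range k, ∏ j ∈ range n, pr p (fun ω => M.R i j ω = r i j), fun y => ?_⟩
    obtain ⟨y, rfl⟩ := exists_extend y
    have hseed : ∀ ω, M.seed ω = v ∧ inputVec n X ω = (fun i : Fin n => y i) ↔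
        M.init ω = v.1 ∧ (∀ i < k, ∀ j < n, M.R i j ω = r i j) ∧ ∀ j < n, X j ω = y j := by
      intro ω
      rw [inputVec_eq_iff, ← and_assoc]
      refine and_congr_left fun _ => ?_
      rw [Prod.ext_iff]
      refine and_congr_right fun _ => ⟨fun h i hi j hj => ?_, fun h => ?_⟩
      · simp only [hr, hi, hj, and_self, dif_pos]
        exact congrFun (congrFun h ⟨i, hi⟩) ⟨j, hj⟩
      · funext i j
        refine (h i i.2 j j.2).trans ?_
        simp [hr]
    rw [pr_congr hseed, M.indep, ← pr_congr (inputVec_eq_iff y), pr_inputVec hX hu,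
      mul_one_div]
  have hsum := sum_pr_and (p := p) (inputVec n X) fun ω => M.seed ω = v
  simp only [hA, sum_const, card_univ, nsmul_eq_mul] at hsum
  rw [hA, ← hsum]
  congr 1
  field_simp

/-- A prediction of the sign of the sum through the final state is, on some fixed choice of the
random seeds, at least as good for uniform inputs. -/
lemma Alg.exists_seed (M : Alg Ω p Bool n k X) (hp : IsPMF p) (hX : IsProduct p n X)
    (hu : ∀ j < n, ∀ b : Bool, pr p (fun ω => X j ω = b) = 1 / 2)
    {w : (Fin n → Bool) → M.S → ℝ} {c : ℝ}
    (hw : c ≤ ∑ ω, p ω * w (inputVec n X ω) (M.passEnd k ω)) :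
    ∃ v : M.S × (Fin k → Fin n → M.Rv),
      c ≤ 𝔼 x, w x (detEnd (M.detStep v.2) x v.1 k) := by
  simp only [M.passEnd_eq_detEnd _ k le_rfl] at hw
  rw [sum_mul_eq_sum_mul_expect (V := M.seed) (W := inputVec n X)
    (M.pr_seed_and_inputVec hp hX hu)
    fun v x => w x (detEnd (M.detStep v.2) x v.1 k)] at hw
  obtain ⟨ω, hω⟩ := hp.exists_le hw
  exact ⟨M.seed ω, hω⟩

/-- The conditional probability of the output `b` given the final state. -/
def Alg.outProb (M : Alg Ω p Bool n k X) (Out : Ω → Bool) (b : Bool) (m : M.S) : ℝ :=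
  pr p (fun ω => Out ω = b ∧ M.passEnd k ω = m) / pr p (fun ω => M.passEnd k ω = m)

lemma Alg.outProb_nonneg (M : Alg Ω p Bool n k X) (hp : IsPMF p) (Out : Ω → Bool) (b : Bool)
    (m : M.S) : 0 ≤ M.outProb Out b m :=
  div_nonneg (hp.pr_nonneg _) (hp.pr_nonneg _)

lemma Alg.outProb_add_le (M : Alg Ω p Bool n k X) (Out : Ω → Bool) (m : M.S) :
    M.outProb Out true m + M.outProb Out false m ≤ 1 := by
  have h := sum_pr_and (p := p) Out fun ω => M.passEnd k ω = m
  rw [Fintype.sum_bool] at h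
  simp only [and_comm (a := M.passEnd k _ = m)] at h
  rw [Alg.outProb, Alg.outProb, ← add_div, h]
  exact div_self_le_one _

/-- The success probability on input `x` with final state `m`. -/
def Alg.successProb (M : Alg Ω p Bool n k X) (Out : Ω → Bool) (x : Fin n → Bool) (m : M.S) : ℝ :=
  if blockSum 0 n x = 0 then 1 else M.outProb Out (decide (0 < blockSum 0 n x)) m

lemma Alg.pr_success_le (M : Alg Ω p Bool n k X) (hp : IsPMF p) {Out : Ω → Bool}
    (hOut : ∀ (b : Bool) (x : ℕ → Bool) (m : M.S),
      pr p (fun ω => Out ω = b ∧ (∀ j < n, X j ω = x j) ∧ M.passEnd k ω = m) *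
          pr p (fun ω => M.passEnd k ω = m)
        = pr p (fun ω => Out ω = b ∧ M.passEnd k ω = m) *
          pr p (fun ω => (∀ j < n, X j ω = x j) ∧ M.passEnd k ω = m)) :
    pr p (fun ω => (∑ j ∈ Finset.range n, coin (X j ω)) = 0 ∨
        (Out ω = true ∧ 0 < ∑ j ∈ Finset.range n, coin (X j ω)) ∨
        (Out ω = false ∧ (∑ j ∈ Finset.range n, coin (X j ω)) < 0))
      ≤ ∑ ω, p ω * M.successProb Out (inputVec n X ω) (M.passEnd k ω) := by
  rw [← sum_pr_and (fun ω => (inputVec n X ω, M.passEnd k ω)),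
    ← sum_pr_mul (fun ω => (inputVec n X ω, M.passEnd k ω)) fun q => M.successProb Out q.1 q.2]
  refine sum_le_sum fun q _ => ?_
  obtain ⟨x, m⟩ := q
  simp only [← blockSum_inputVec, Prod.mk.injEq, Alg.successProb]
  split_ifs with h0
  · rw [mul_one]
    exact hp.pr_mono fun ω h => h.2
  · set b : Bool := decide (0 < blockSum 0 n x) with hb
    have hle : pr p (fun ω => (blockSum 0 n (inputVec n X ω) = 0 ∨
        (Out ω = true ∧ 0 < blockSum 0 n (inputVec n X ω)) ∨
        (Out ω = false ∧ blockSum 0 n (inputVec n X ω) < 0)) ∧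
          inputVec n X ω = x ∧ M.passEnd k ω = m)
        ≤ pr p (fun ω => Out ω = b ∧ inputVec n X ω = x ∧ M.passEnd k ω = m) := by
      refine hp.pr_mono fun ω h => ⟨?_, h.2⟩
      rw [h.2.1] at h
      rcases h.1 with h | h | h
      · exact absurd h h0
      · simp [hb, h]
      · simp [hb, h, h.2.le]
    refine hle.trans ?_
    obtain ⟨x, rfl⟩ := exists_extend x
    simp only [inputVec_eq_iff]
    rcases (hp.pr_nonneg fun ω => M.passEnd k ω = m).eq_or_lt with h | h
    · refine (hp.pr_mono fun ω h => h.2.2).trans (h.symm.le.trans ?_)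
      exact mul_nonneg (hp.pr_nonneg _) (M.outProb_nonneg hp _ _ _)
    · rw [Alg.outProb, mul_div_assoc', le_div_iff₀ h, hOut, mul_comm]

end Reduction

/-- Corollary `singlemaj` / Theorem 1.1, coin problem: there are
constants `c > 0` and `n₀` such that for all `n ≥ n₀`, for every `k < log₂ n`, any
`k`-pass streaming algorithm using `s` bits of memory on a stream of `n` i.i.d. uniform
`{-1,1}` bits — whose output bit `Out` is a (possibly randomized) function of the final
memory state `M_{(k,n)}`, formalized as conditional independence of `Out` from the input
given the final state — that computes the majority bit with probability at least `0.999`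
must satisfy `s ≥ c·(log₂ n)/k`. -/
theorem coin_problem_multipass_lower_bound :
    ∃ c : ℝ, 0 < c ∧ ∃ n₀ : ℕ,
      ∀ n : ℕ, n₀ ≤ n →
        ∀ (k s : ℕ) (Ω : Type) [Fintype Ω], ∀ (p : Ω → ℝ) (X : ℕ → Ω → Bool)
          (M : Alg Ω p Bool n k X) (Out : Ω → Bool),
          IsPMF p →
          IsProduct p n X →
          (∀ j < n, ∀ b : Bool, pr p (fun ω => X j ω = b) = 1 / 2) →
          (k : ℝ) < Real.logb 2 n →
          Fintype.card M.S ≤ 2 ^ s →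
          -- `Out` is conditionally independent of the input given the final memory state:
          (∀ (b : Bool) (x : ℕ → Bool) (m : M.S),
            pr p (fun ω => Out ω = b ∧ (∀ j < n, X j ω = x j) ∧ M.passEnd k ω = m) *
                pr p (fun ω => M.passEnd k ω = m)
              = pr p (fun ω => Out ω = b ∧ M.passEnd k ω = m) *
                pr p (fun ω => (∀ j < n, X j ω = x j) ∧ M.passEnd k ω = m)) →
          -- the algorithm outputs the majority bit with probability at least 0.999:
          (0.999 : ℝ) ≤ pr p (fun ω =>
              (∑ j ∈ Finset.range n, coin (X j ω)) = 0 ∨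
              (Out ω = true ∧ 0 < ∑ j ∈ Finset.range n, coin (X j ω)) ∨
              (Out ω = false ∧ (∑ j ∈ Finset.range n, coin (X j ω)) < 0)) →
          c * Real.logb 2 n / k ≤ (s : ℝ) := by
  refine ⟨0.001, by norm_num, 64 ^ 5, ?_⟩
  intro n hn k s Ω _ p X M Out hp hX hu _ hcard hOut hsucc
  rcases Nat.eq_zero_or_pos k with rfl | hk
  · simp
  obtain ⟨v, hv⟩ := M.exists_seed hp hX hu (hsucc.trans (M.pr_success_le hp hOut))
  have hq0 := M.outProb_nonneg hp Out
  have hq1 := M.outProb_add_le Out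
  have hw0 : ∀ x m, 0 ≤ M.successProb Out x m := fun x m => by
    unfold Alg.successProb
    split_ifs
    exacts [zero_le_one, hq0 _ m]
  have hw1 : ∀ x m, M.successProb Out x m ≤ 1 := fun x m => by
    unfold Alg.successProb
    split_ifs
    · exact le_rfl
    · have h1 := hq0 true m
      have h2 := hq0 false m
      have h3 := hq1 m
      cases decide (0 < blockSum 0 n x) <;> linarith
  have hhw : ∀ x m, |blockSum 0 n x| * (2 * M.successProb Out x m - 1)
      ≤ blockSum 0 n x * (2 * M.outProb Out true m - 1) := fun x m => by
    unfold Alg.successProb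
    rcases lt_trichotomy (blockSum 0 n x) 0 with h | h | h
    · rw [if_neg h.ne, decide_eq_false h.le.not_gt, abs_of_neg h]
      nlinarith [hq1 m]
    · simp [h]
    · rw [if_neg h.ne', decide_eq_true h, abs_of_pos h]
  have key := log_le_of_detEnd hk (M.detStep v.2) v.1
    (h := fun m => 2 * M.outProb Out true m - 1)
    (fun m => abs_le.2 ⟨by linarith [hq0 true m], by linarith [hq0 false m, hq1 m]⟩)
    (fun x => hw1 x _) (fun x => hw0 x _) (fun x => hhw x _) hv hn
  have : Nonempty M.S := ⟨v.1⟩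
  have hs : Real.logb 2 (Fintype.card M.S) ≤ s := by
    have h := Real.logb_le_logb_of_le (b := 2) (by norm_num)
      (by exact_mod_cast Fintype.card_pos) (by exact_mod_cast hcard : (Fintype.card M.S : ℝ) ≤ 2 ^ s)
    rwa [Real.logb_pow, Real.logb_self_eq_one (by norm_num), mul_one] at h
  have hkR : (0 : ℝ) < k := by exact_mod_cast hk
  rw [div_le_iff₀ hkR, mul_comm (s : ℝ)]
  exact key.trans (mul_le_mul_of_nonneg_left hs hkR.le)

end MultiPassIC
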